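/- arXiv:2308.01768 — 6 statements merged into one kernel-verified Lean document; each statement's English description precedes it below -/
import Mathlib

section
/- For every n ≥ 1, the matrix C = diag(c₁)·C̄ is invertible and C^{−1} = C̄ᵀ·diag(d), where d ∈ ℝ^n is the vector with d[i] = C̄[i,1]. -/
open Matrix

/-- The discrete cosine transform matrix `C̄ ∈ ℝ^{n×n}` with (1-based) entries
`C̄[i,j] = √((2 − δ_{i,1})/n)·cos((i−1)(2j−1)π/(2n))`. -/
noncomputable def dctBar (n : ℕ) : Matrix (Fin n) (Fin n) ℝ :=
  fun i j => Real.sqrt ((2 - if i.val = 0 then 1 else 0) / n) *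
    Real.cos ((i.val : ℝ) * (2 * (j.val : ℝ) + 1) * Real.pi / (2 * n))

/-- The vector `c₁ ∈ ℝ^n` with `c₁[i] = 1/C̄[i,1]`. -/
noncomputable def cOne (n : ℕ) (hn : 1 ≤ n) : Fin n → ℝ :=
  fun i => 1 / dctBar n i ⟨0, hn⟩

/-- The matrix `C = diag(c₁)·C̄`. -/
noncomputable def Cmat (n : ℕ) (hn : 1 ≤ n) : Matrix (Fin n) (Fin n) ℝ :=
  Matrix.diagonal (cOne n hn) * dctBar n

/-- Dirichlet-kernel type identity for odd multiples of an angle. -/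
theorem two_mul_sin_mul_sum_cos_odd (n : ℕ) (a : ℝ) :
    2 * Real.sin a * ∑ j ∈ Finset.range n, Real.cos ((2 * (j : ℝ) + 1) * a) =
      Real.sin (2 * n * a) := by
  induction n with
  | zero => simp
  | succ n ih =>
    rw [Finset.sum_range_succ, mul_add, ih]
    have h₁ : 2 * (n : ℝ) * a = (2 * (n : ℝ) + 1) * a - a := by ring
    have h₂ : 2 * ((n + 1 : ℕ) : ℝ) * a = (2 * (n : ℝ) + 1) * a + a := by push_cast; ring
    rw [h₁, h₂, Real.sin_add, Real.sin_sub]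
    ring

theorem sum_cos_odd_mul_eq_zero {n : ℕ} {m : ℤ} (hm : m ≠ 0) (hlt : |m| < 2 * n) :
    ∑ j : Fin n, Real.cos ((m : ℝ) * (2 * (j.val : ℝ) + 1) * Real.pi / (2 * n)) = 0 := by
  have hn : (n : ℝ) ≠ 0 := by
    rintro h
    rw [Nat.cast_eq_zero] at h
    subst h
    exact (abs_nonneg m).not_gt (by simpa using hlt)
  have hsin : Real.sin (m * Real.pi / (2 * n)) ≠ 0 := by
    rw [Ne, Real.sin_eq_zero_iff]
    rintro ⟨k, hk⟩
    field_simp at hk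
    have hdvd : (2 * n : ℤ) ∣ m := ⟨k, by
      have : (m : ℝ) = 2 * n * k := by linarith
      exact_mod_cast this⟩
    exact hm (Int.eq_zero_of_abs_lt_dvd hdvd hlt)
  have key := two_mul_sin_mul_sum_cos_odd n (m * Real.pi / (2 * n))
  have hπ : 2 * (n : ℝ) * (m * Real.pi / (2 * n)) = m * Real.pi := by field_simp
  rw [hπ, Real.sin_int_mul_pi, mul_eq_zero] at key
  rw [Fin.sum_univ_eq_sum_range
    (fun j : ℕ => Real.cos ((m : ℝ) * (2 * (j : ℝ) + 1) * Real.pi / (2 * n)))]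
  rw [← key.resolve_left (mul_ne_zero two_ne_zero hsin)]
  refine Finset.sum_congr rfl fun j _ => ?_
  congr 1
  ring

theorem sum_cos_mul_cos_dct {n : ℕ} (i k : Fin n) :
    ∑ j : Fin n, Real.cos ((i.val : ℝ) * (2 * (j.val : ℝ) + 1) * Real.pi / (2 * n)) *
        Real.cos ((k.val : ℝ) * (2 * (j.val : ℝ) + 1) * Real.pi / (2 * n)) =
      if i = k then (if i.val = 0 then (n : ℝ) else n / 2) else 0 := by
  have hprod (j : Fin n) :
      Real.cos ((i.val : ℝ) * (2 * (j.val : ℝ) + 1) * Real.pi / (2 * n)) *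
        Real.cos ((k.val : ℝ) * (2 * (j.val : ℝ) + 1) * Real.pi / (2 * n)) =
      (Real.cos (((i.val - k.val : ℤ) : ℝ) * (2 * (j.val : ℝ) + 1) * Real.pi / (2 * n)) +
        Real.cos (((i.val + k.val : ℤ) : ℝ) * (2 * (j.val : ℝ) + 1) * Real.pi / (2 * n))) / 2 := by
    push_cast
    rw [sub_mul, sub_mul, sub_div, add_mul, add_mul, add_div _ _ (2 * (n : ℝ)), Real.cos_sub, Real.cos_add]
    ring
  have hi := i.isLt
  have hk := k.isLt
  simp_rw [hprod]
  rw [← Finset.sum_div, Finset.sum_add_distrib]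
  split_ifs with hik h0
  · subst hik
    simp [h0]
  · subst hik
    rw [sum_cos_odd_mul_eq_zero (m := (i.val + i.val : ℤ)) (by omega)
      (by rw [abs_lt]; omega)]
    simp
  · have hne : i.val ≠ k.val := fun h => hik (Fin.ext h)
    rw [sum_cos_odd_mul_eq_zero (m := (i.val - k.val : ℤ)) (by omega)
        (by rw [abs_lt]; omega),
      sum_cos_odd_mul_eq_zero (m := (i.val + k.val : ℤ)) (by omega)
        (by rw [abs_lt]; omega)]
    simp

theorem dctBar_mul_transpose (n : ℕ) : dctBar n * (dctBar n)ᵀ = 1 := by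
  ext i k
  have hn : (n : ℝ) ≠ 0 := by
    have := i.isLt
    exact_mod_cast (by omega : n ≠ 0)
  simp only [Matrix.mul_apply, Matrix.transpose_apply, dctBar]
  rw [Finset.sum_congr rfl fun _ _ => mul_mul_mul_comm _ _ _ _, ← Finset.mul_sum, sum_cos_mul_cos_dct, Matrix.one_apply]
  rcases eq_or_ne i k with rfl | hik
  · rw [Real.mul_self_sqrt (div_nonneg (by split_ifs <;> norm_num) n.cast_nonneg)]
    split_ifs <;> field_simp <;> norm_num
  · simp [hik]

theorem dctBar_apply_zero_ne_zero {n : ℕ} (hn : 1 ≤ n) (i : Fin n) :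
    dctBar n i ⟨0, hn⟩ ≠ 0 := by
  have hn' : (0 : ℝ) < n := by exact_mod_cast hn
  have hi : (i.val : ℝ) < n := by exact_mod_cast i.isLt
  refine mul_ne_zero (Real.sqrt_pos.2 (div_pos ?_ hn')).ne' (Real.cos_pos_of_mem_Ioo ⟨?_, ?_⟩).ne'
  · split_ifs <;> norm_num
  · have : 0 ≤ (i.val : ℝ) * (2 * ((0 : ℕ) : ℝ) + 1) * Real.pi / (2 * n) := by positivity
    linarith [Real.pi_pos]
  · rw [div_lt_div_iff₀ (by positivity) two_pos]
    have := mul_lt_mul_of_pos_right hi Real.pi_pos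
    push_cast
    linarith

/-- For every `n ≥ 1`, the matrix `C = diag(c₁)·C̄` is invertible and
`C⁻¹ = C̄ᵀ·diag(d)`, where `d[i] = C̄[i,1]`. -/
theorem Cmat_inv (n : ℕ) (hn : 1 ≤ n) :
    IsUnit (Cmat n hn) ∧
      (Cmat n hn)⁻¹ = (dctBar n)ᵀ * Matrix.diagonal (fun i => dctBar n i ⟨0, hn⟩) := by
  have hdiag : Matrix.diagonal (cOne n hn) *
      Matrix.diagonal (fun i => dctBar n i ⟨0, hn⟩) = 1 := by
    rw [Matrix.diagonal_mul_diagonal, ← Matrix.diagonal_one]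
    congr 1
    funext i
    exact one_div_mul_cancel (dctBar_apply_zero_ne_zero hn i)
  have hmul : Cmat n hn *
      ((dctBar n)ᵀ * Matrix.diagonal (fun i => dctBar n i ⟨0, hn⟩)) = 1 := by
    rw [Cmat, Matrix.mul_assoc, ← Matrix.mul_assoc (dctBar n), dctBar_mul_transpose,
      Matrix.one_mul, hdiag]
  exact ⟨IsUnit.of_mul_eq_one _ hmul, Matrix.inv_eq_right_inv hmul⟩
end

section
/- For every n ≥ 1 and every a ∈ ℝ^n, Th(a) = C^{−1} · diag(C·Γ·a) · C, where C = diag(c₁)·C̄ (in particular C is invertible). -/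
open Matrix

/-- The Toeplitz-plus-Hankel matrix `Th(a) ∈ ℝ^{n×n}` (1-based formula):
`Th(a)[i,j] = a[|i−j|+1] + (1 − δ_{i+j,n+1})·b_{ij}`, where `b_{ij} = a[i+j]`
if `i+j ≤ n` and `b_{ij} = a[2(n+1)−(i+j)]` if `i+j > n`.
Indices `i j : Fin n` correspond to 1-based indices `i.val+1`, `j.val+1`. -/
noncomputable def thMat {n : ℕ} (a : Fin n → ℝ) : Matrix (Fin n) (Fin n) ℝ :=
  fun i j =>
    a ⟨i.val - j.val + (j.val - i.val), by have := i.isLt; have := j.isLt; omega⟩ +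
    if hd : i.val + j.val + 1 = n then 0
    else if hle : i.val + j.val + 2 ≤ n then a ⟨i.val + j.val + 1, by omega⟩
    else a ⟨2 * n - 1 - (i.val + j.val), by have := i.isLt; have := j.isLt; omega⟩

/-- The unit upper bidiagonal matrix `Γ ∈ ℝ^{n×n}` with `Γ[i,i] = 1`,
`Γ[i,i+1] = 1` for `i < n`, and all other entries `0`. -/
def gammaMat (n : ℕ) : Matrix (Fin n) (Fin n) ℝ :=
  fun i j => if j.val = i.val then 1 else if j.val = i.val + 1 then 1 else 0

/-- The `m`-th coefficient of the eigenvalue of `thMat` at the angle `θ`. -/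
noncomputable def thCoeff (θ : ℝ) (m : ℕ) : ℝ :=
  if m = 0 then 1 else 2 * Real.cos (2 * m * θ)

theorem cos_angle_pos {n : ℕ} (k : Fin n) : 0 < Real.cos ((k.val : ℝ) * Real.pi / (2 * n)) := by
  have hk : (k.val : ℝ) < n := by exact_mod_cast k.isLt
  have hn : (0 : ℝ) < n := lt_of_le_of_lt (Nat.cast_nonneg _) hk
  apply Real.cos_pos_of_mem_Ioo
  constructor
  · have : 0 ≤ (k.val : ℝ) * Real.pi / (2 * n) := by positivity
    linarith [Real.pi_pos]
  · rw [div_lt_div_iff₀ (by positivity) (by positivity)]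
    nlinarith [Real.pi_pos]

theorem Cmat_apply {n : ℕ} (hn : 1 ≤ n) (k j : Fin n) :
    Cmat n hn k j = Real.cos ((2 * j.val + 1) * ((k.val : ℝ) * Real.pi / (2 * n))) /
      Real.cos ((k.val : ℝ) * Real.pi / (2 * n)) := by
  have hn' : (0 : ℝ) < n := by exact_mod_cast hn
  have hs : Real.sqrt ((2 - if k.val = 0 then 1 else 0) / n) ≠ 0 := by
    apply ne_of_gt
    apply Real.sqrt_pos.2
    split_ifs <;> norm_num <;> omega
  have hc := (cos_angle_pos k).ne'
  have e : (k.val : ℝ) * (2 * (j.val : ℝ) + 1) * Real.pi / (2 * n) =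
      (2 * j.val + 1) * ((k.val : ℝ) * Real.pi / (2 * n)) := by ring
  simp only [Cmat, diagonal_mul, cOne, dctBar, e, Nat.cast_zero, mul_zero, zero_add, mul_one]
  field_simp

theorem thMat_apply_eq_sum {n : ℕ} (a : Fin n → ℝ) (i j : Fin n) :
    thMat a i j = ∑ m : Fin n, a m *
      ((if i.val + m.val = j.val ∨ j.val + m.val = i.val then 1 else 0) +
        (if i.val + j.val + 1 = m.val ∨ i.val + j.val + 1 + m.val = 2 * n then 1 else 0)) := by
  have hi := i.isLt
  have hj := j.isLt
  simp only [mul_add, Finset.sum_add_distrib, mul_ite, mul_one, mul_zero, thMat]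
  congr 1
  · have h : ∀ m : Fin n, (i.val + m.val = j.val ∨ j.val + m.val = i.val) ↔
        m = ⟨i.val - j.val + (j.val - i.val), by omega⟩ := by
      intro m
      rw [Fin.ext_iff]
      dsimp only
      omega
    simp [h]
  · split_ifs with hd hle
    · symm
      apply Finset.sum_eq_zero
      intro m _
      have := m.isLt
      rw [if_neg (by omega)]
    · have h : ∀ m : Fin n, (i.val + j.val + 1 = m.val ∨ i.val + j.val + 1 + m.val = 2 * n) ↔
          m = ⟨i.val + j.val + 1, by omega⟩ := by
        intro m
        have := m.isLt
        rw [Fin.ext_iff]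
        dsimp only
        omega
      simp [h]
    · have h : ∀ m : Fin n, (i.val + j.val + 1 = m.val ∨ i.val + j.val + 1 + m.val = 2 * n) ↔
          m = ⟨2 * n - 1 - (i.val + j.val), by omega⟩ := by
        intro m
        have := m.isLt
        rw [Fin.ext_iff]
        dsimp only
        omega
      simp [h]

theorem sum_cos_mul_indicator {n : ℕ} {θ : ℝ} {k : ℕ} (hθ : 4 * n * θ = k * (2 * Real.pi))
    (m j : Fin n) :
    ∑ i : Fin n, Real.cos ((2 * i.val + 1) * θ) *
      ((if i.val + m.val = j.val ∨ j.val + m.val = i.val then 1 else 0) +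
        (if i.val + j.val + 1 = m.val ∨ i.val + j.val + 1 + m.val = 2 * n then 1 else 0)) =
      thCoeff θ m * Real.cos ((2 * j.val + 1) * θ) := by
  have hm := m.isLt
  have hj := j.isLt
  by_cases h0 : m.val = 0
  · have h : ∀ i : Fin n,
        ((if i.val + m.val = j.val ∨ j.val + m.val = i.val then 1 else 0) +
        (if i.val + j.val + 1 = m.val ∨ i.val + j.val + 1 + m.val = 2 * n then 1 else 0) : ℝ) =
        if i = j then 1 else 0 := by
      intro i
      have := i.isLt
      rw [if_neg (show ¬ (i.val + j.val + 1 = m.val ∨ i.val + j.val + 1 + m.val = 2 * n) by omega),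
        add_zero]
      simp only [Fin.ext_iff]
      exact if_congr (by omega) rfl rfl
    simp only [h]
    simp [thCoeff, h0]
  · obtain ⟨p, hp, hpc⟩ : ∃ p : Fin n,
        (∀ i : Fin n, (i.val + m.val = j.val ∨ i.val + j.val + 1 = m.val) ↔ i = p) ∧
        Real.cos ((2 * p.val + 1) * θ) = Real.cos ((2 * j.val + 1) * θ - 2 * m.val * θ) := by
      by_cases h : m.val ≤ j.val
      · refine ⟨⟨j.val - m.val, by omega⟩, fun i => by rw [Fin.ext_iff]; dsimp only; omega, ?_⟩
        congr 1
        push_cast [h]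
        ring
      · refine ⟨⟨m.val - 1 - j.val, by omega⟩,
          fun i => by rw [Fin.ext_iff]; dsimp only; omega, ?_⟩
        rw [← Real.cos_neg]
        congr 1
        simp only [Nat.sub_sub]
        rw [Nat.cast_sub (by omega)]
        push_cast
        ring
    obtain ⟨q, hq, hqc⟩ : ∃ q : Fin n,
        (∀ i : Fin n, (j.val + m.val = i.val ∨ i.val + j.val + 1 + m.val = 2 * n) ↔ i = q) ∧
        Real.cos ((2 * q.val + 1) * θ) = Real.cos ((2 * j.val + 1) * θ + 2 * m.val * θ) := by
      by_cases h : j.val + m.val < n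
      · refine ⟨⟨j.val + m.val, h⟩,
          fun i => by have := i.isLt; rw [Fin.ext_iff]; dsimp only; omega, ?_⟩
        congr 1
        push_cast
        ring
      · refine ⟨⟨2 * n - (1 + j.val + m.val), by omega⟩,
          fun i => by have := i.isLt; rw [Fin.ext_iff]; dsimp only; omega, ?_⟩
        rw [← Real.cos_nat_mul_two_pi_sub _ k, ← hθ]
        congr 1
        rw [Nat.cast_sub (by omega)]
        push_cast
        ring
    have h : ∀ i : Fin n,
        ((if i.val + m.val = j.val ∨ j.val + m.val = i.val then 1 else 0) +
        (if i.val + j.val + 1 = m.val ∨ i.val + j.val + 1 + m.val = 2 * n then 1 else 0) : ℝ) =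
        (if i = p then 1 else 0) + if i = q then 1 else 0 := by
      intro i
      have := i.isLt
      simp only [← hp, ← hq]
      split_ifs <;> first | omega | norm_num
    simp only [h, mul_add, mul_ite, mul_one, mul_zero, Finset.sum_add_distrib,
      Finset.sum_ite_eq', Finset.mem_univ, if_true, hpc, hqc, thCoeff, h0, if_false]
    rw [Real.cos_sub, Real.cos_add]
    ring

theorem Cmat_mul_thMat_apply {n : ℕ} (hn : 1 ≤ n) (a : Fin n → ℝ) (k j : Fin n) :
    (Cmat n hn * thMat a) k j =
      (∑ m : Fin n, a m * thCoeff ((k.val : ℝ) * Real.pi / (2 * n)) m) * Cmat n hn k j := by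
  have hn' : (n : ℝ) ≠ 0 := by exact_mod_cast (by omega : n ≠ 0)
  have hθ : 4 * n * ((k.val : ℝ) * Real.pi / (2 * n)) = k.val * (2 * Real.pi) := by
    field_simp
    ring
  simp only [mul_apply, thMat_apply_eq_sum, Cmat_apply hn, Finset.mul_sum]
  rw [Finset.sum_comm, Finset.sum_mul]
  refine Finset.sum_congr rfl fun m _ => ?_
  rw [mul_assoc, ← mul_div_assoc, ← sum_cos_mul_indicator hθ m j, Finset.sum_div, Finset.mul_sum]
  refine Finset.sum_congr rfl fun i _ => ?_
  ring

theorem Cmat_mulVec_gammaMat_mulVec {n : ℕ} (hn : 1 ≤ n) (a : Fin n → ℝ) (k : Fin n) :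
    (Cmat n hn *ᵥ (gammaMat n *ᵥ a)) k =
      ∑ m : Fin n, a m * thCoeff ((k.val : ℝ) * Real.pi / (2 * n)) m := by
  have hc := (cos_angle_pos k).ne'
  rw [mulVec_mulVec, mulVec, dotProduct]
  refine Finset.sum_congr rfl fun m _ => ?_
  rw [mul_comm, mul_apply]
  congr 1
  have hm := m.isLt
  by_cases h0 : m.val = 0
  · have h : ∀ i : Fin n, gammaMat n i m = if i = m then 1 else 0 := by
      intro i
      simp only [gammaMat, Fin.ext_iff]
      split_ifs <;> first | omega | rfl
    simp [h, Cmat_apply, thCoeff, h0, hc]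
  · have h : ∀ i : Fin n, gammaMat n i m =
        (if i = m then 1 else 0) + if i = ⟨m.val - 1, by omega⟩ then 1 else 0 := by
      intro i
      simp only [gammaMat, Fin.ext_iff]
      split_ifs <;> first | omega | norm_num
    simp only [h, mul_add, mul_ite, mul_one, mul_zero, Finset.sum_add_distrib,
      Finset.sum_ite_eq', Finset.mem_univ, if_true, Cmat_apply, thCoeff, h0, if_false]
    rw [← add_div, div_eq_iff hc, Nat.cast_sub (by omega)]
    set θ := (k.val : ℝ) * Real.pi / (2 * n)
    rw [show (2 * (m.val : ℝ) + 1) * θ = 2 * m.val * θ + θ by ring,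
      show (2 * ((m.val : ℝ) - (1 : ℕ)) + 1) * θ = 2 * m.val * θ - θ by push_cast; ring,
      Real.cos_add, Real.cos_sub]
    ring

theorem Cmat_mul_thMat {n : ℕ} (hn : 1 ≤ n) (a : Fin n → ℝ) :
    Cmat n hn * thMat a =
      Matrix.diagonal (Cmat n hn *ᵥ (gammaMat n *ᵥ a)) * Cmat n hn := by
  ext k j
  rw [Cmat_mul_thMat_apply, diagonal_mul, Cmat_mulVec_gammaMat_mulVec]

theorem cos_two_mul_angle_injective {n : ℕ} :
    Function.Injective fun k : Fin n => 2 * Real.cos (2 * ((k.val : ℝ) * Real.pi / (2 * n))) := by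
  intro k l h
  have hn : (0 : ℝ) < n := by exact_mod_cast k.pos
  have mem : ∀ k : Fin n, 2 * ((k.val : ℝ) * Real.pi / (2 * n)) ∈ Set.Icc 0 Real.pi := by
    intro k
    have hk : (k.val : ℝ) ≤ n := by exact_mod_cast k.isLt.le
    refine ⟨by positivity, ?_⟩
    rw [show 2 * ((k.val : ℝ) * Real.pi / (2 * n)) = k.val * Real.pi / n by field_simp,
      div_le_iff₀ hn]
    nlinarith [Real.pi_pos]
  have h2 := Real.injOn_cos (mem k) (mem l) (mul_left_cancel₀ two_ne_zero h)
  have := Real.pi_pos.ne'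
  field_simp at h2
  exact Fin.ext (by exact_mod_cast h2)

/-- The rows of `Cmat` are left eigenvectors of one `thMat` with distinct eigenvalues. -/
theorem isUnit_Cmat {n : ℕ} (hn : 1 ≤ n) : IsUnit (Cmat n hn) := by
  rw [← linearIndependent_rows_iff_isUnit]
  have hne : ∀ k, (Cmat n hn).row k ≠ 0 := by
    intro k h
    have := congrFun h ⟨0, hn⟩
    simp [Cmat_apply, (cos_angle_pos k).ne'] at this
  obtain rfl | h2 : n = 1 ∨ 1 < n := by omega
  · exact linearIndependent_unique_iff.2 (hne _)
  let a : Fin n → ℝ := Pi.single ⟨1, h2⟩ 1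
  refine Module.End.eigenvectors_linearIndependent' (Matrix.vecMulLinear (thMat a))
    _ cos_two_mul_angle_injective _ fun k => ⟨?_, hne k⟩
  rw [Module.End.mem_eigenspace_iff]
  ext j
  have := Cmat_mul_thMat_apply hn a k j
  simp only [a, Pi.single_apply, ite_mul, one_mul, zero_mul, Finset.sum_ite_eq', Finset.mem_univ,
    if_true] at this
  simpa [thCoeff, mul_apply, vecMul, dotProduct] using this

/-- For every `n ≥ 1` and every `a ∈ ℝ^n`,
`Th(a) = C⁻¹·diag(C·Γ·a)·C` where `C = diag(c₁)·C̄` (in particular `C` is invertible). -/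
theorem thMat_eq_Cinv_diag_C (n : ℕ) (hn : 1 ≤ n) (a : Fin n → ℝ) :
    IsUnit (Cmat n hn) ∧
      thMat a =
        (Cmat n hn)⁻¹ * Matrix.diagonal (Cmat n hn *ᵥ (gammaMat n *ᵥ a)) * Cmat n hn := by
  have hC := isUnit_Cmat hn
  refine ⟨hC, ?_⟩
  rw [mul_assoc, ← Cmat_mul_thMat, nonsing_inv_mul_cancel_left _ _
    ((isUnit_iff_isUnit_det _).1 hC)]
end

section
/- The vector ⋆_c product is associative: for every n ≥ 1 and all a, b, x ∈ ℝ^n, b ⋆_c (a ⋆_c x) = (b ⋆_c a) ⋆_c x, i.e., Th(Γ^{−1}·b)·(Th(Γ^{−1}·a)·x) = Th(Γ^{−1}·(Th(Γ^{−1}·b)·a))·x. -/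
open Matrix

/-- The vector `⋆_c` product `u ⋆_c v := Th(Γ⁻¹·u)·v`. -/
noncomputable def starcVec {n : ℕ} (u v : Fin n → ℝ) : Fin n → ℝ :=
  thMat ((gammaMat n)⁻¹ *ᵥ u) *ᵥ v

/-- The even extension of `a` to `ℤ/2nℤ`, with value `0` at `n`. -/
noncomputable def evenExt {n : ℕ} (a : Fin n → ℝ) (k : ZMod (2 * n)) : ℝ :=
  if h : k.val < n then a ⟨k.val, h⟩
  else if h' : n < k.val ∧ k.val < 2 * n then a ⟨2 * n - k.val, by omega⟩
  else 0

theorem evenExt_natCast_of_lt {n : ℕ} (a : Fin n → ℝ) {m : ℕ} (hm : m < n) :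
    evenExt a (m : ZMod (2 * n)) = a ⟨m, hm⟩ := by
  have hv : (m : ZMod (2 * n)).val = m := ZMod.val_cast_of_lt (by omega)
  simp [evenExt, hv, hm]

theorem evenExt_natCast_self {n : ℕ} (hn : 1 ≤ n) (a : Fin n → ℝ) :
    evenExt a (n : ZMod (2 * n)) = 0 := by
  have hv : (n : ZMod (2 * n)).val = n := ZMod.val_cast_of_lt (by omega)
  simp [evenExt, hv]

theorem evenExt_natCast_of_gt {n : ℕ} (a : Fin n → ℝ) {m : ℕ} (hm : n < m) (hm' : m < 2 * n) :
    evenExt a (m : ZMod (2 * n)) = a ⟨2 * n - m, by omega⟩ := by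
  have hv : (m : ZMod (2 * n)).val = m := ZMod.val_cast_of_lt hm'
  simp [evenExt, hv, hm, hm', hm.le]

theorem evenExt_neg {n : ℕ} (hn : 1 ≤ n) (a : Fin n → ℝ) (k : ZMod (2 * n)) :
    evenExt a (-k) = evenExt a k := by
  have : NeZero (2 * n) := ⟨by omega⟩
  obtain ⟨m, hm, rfl⟩ : ∃ m < 2 * n, (m : ZMod (2 * n)) = k :=
    ⟨k.val, k.val_lt, ZMod.natCast_zmod_val k⟩
  rcases Nat.eq_zero_or_pos m with rfl | hpos
  · simp
  have hneg : -(m : ZMod (2 * n)) = ((2 * n - m : ℕ) : ZMod (2 * n)) := by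
    rw [Nat.cast_sub hm.le, ZMod.natCast_self, zero_sub]
  rw [hneg]
  rcases lt_trichotomy m n with h | rfl | h
  · rw [evenExt_natCast_of_gt a (by omega) (by omega), evenExt_natCast_of_lt a h]
    congr 2
    omega
  · congr 2
    omega
  · rw [evenExt_natCast_of_lt a (by omega), evenExt_natCast_of_gt a h hm]

theorem thMat_apply_eq_evenExt {n : ℕ} (a : Fin n → ℝ) (i j : Fin n) :
    thMat a i j = evenExt a ((i.val : ZMod (2 * n)) - j.val) +
      evenExt a ((i.val : ZMod (2 * n)) + j.val + 1) := by
  have hi := i.isLt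
  have hj := j.isLt
  have hn : 1 ≤ n := by omega
  unfold thMat
  congr 1
  · rcases le_total j.val i.val with h | h
    · rw [← Nat.cast_sub h, evenExt_natCast_of_lt a (by omega)]
      congr 2
      omega
    · rw [← evenExt_neg hn, neg_sub, ← Nat.cast_sub h, evenExt_natCast_of_lt a (by omega)]
      congr 2
      omega
  · have hc : (i.val : ZMod (2 * n)) + j.val + 1 = ((i.val + j.val + 1 : ℕ) : ZMod (2 * n)) := by
      push_cast
      rfl
    rw [hc]
    split_ifs with hd hle
    · rw [hd, evenExt_natCast_self hn]
    · rw [evenExt_natCast_of_lt a (by omega)]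
    · rw [evenExt_natCast_of_gt a (by omega) (by omega)]
      congr 2
      omega

theorem sum_zmod_two_mul {n : ℕ} [NeZero (2 * n)] (f : ZMod (2 * n) → ℝ) :
    ∑ k, f k = ∑ j : Fin n, (f (j.val : ZMod (2 * n)) + f (-1 - (j.val : ZMod (2 * n)))) := by
  have hrange : ∑ k, f k = ∑ m ∈ Finset.range (2 * n), f (m : ZMod (2 * n)) := by
    refine Finset.sum_bij' (fun k _ => k.val) (fun m _ => (m : ZMod (2 * n))) ?_ ?_ ?_ ?_ ?_
    · intro k _
      exact Finset.mem_range.2 k.val_lt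
    · simp
    · simp
    · intro m hm
      exact ZMod.val_cast_of_lt (Finset.mem_range.1 hm)
    · simp
  rw [hrange, show Finset.range (2 * n) = Finset.range (n + n) by rw [two_mul],
    Finset.sum_range_add, Finset.sum_add_distrib,
    Fin.sum_univ_eq_sum_range (fun m => f (m : ZMod (2 * n))),
    Fin.sum_univ_eq_sum_range (fun m => f (-1 - (m : ZMod (2 * n)))),
    ← Finset.sum_range_reflect (fun m => f ((n + m : ℕ) : ZMod (2 * n)))]
  congr 1
  refine Finset.sum_congr rfl fun m hm => ?_
  have hm := Finset.mem_range.1 hm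
  congr 1
  rw [show n + (n - 1 - m) = 2 * n - (1 + m) by omega, Nat.cast_sub (by omega),
    ZMod.natCast_self]
  push_cast
  ring

theorem sum_sub_mul_sub_comm {G : Type*} [AddCommGroup G] [Fintype G] (f g : G → ℝ) (i l : G) :
    ∑ k, f (i - k) * g (k - l) = ∑ k, g (i - k) * f (k - l) := by
  rw [← Equiv.sum_comp (Equiv.subLeft (i + l))]
  refine Finset.sum_congr rfl fun k _ => ?_
  rw [Equiv.subLeft_apply, mul_comm, show i - (i + l - k) = k - l by abel,
    show i + l - k - l = i - k by abel]

theorem thMat_mul_apply {n : ℕ} [NeZero (2 * n)] (a b : Fin n → ℝ) (i l : Fin n) :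
    (thMat a * thMat b) i l =
      ∑ k : ZMod (2 * n), evenExt a (i.val - k) * evenExt b (k - l.val) +
      ∑ k : ZMod (2 * n), evenExt a (i.val - k) * evenExt b (k - (-1 - l.val)) := by
  have hn : 1 ≤ n := i.pos
  rw [← Finset.sum_add_distrib, sum_zmod_two_mul, Matrix.mul_apply]
  refine Finset.sum_congr rfl fun j _ => ?_
  rw [thMat_apply_eq_evenExt, thMat_apply_eq_evenExt,
    ← evenExt_neg hn b (-1 - (j.val : ZMod (2 * n)) - l.val),
    ← evenExt_neg hn b (-1 - (j.val : ZMod (2 * n)) - (-1 - l.val))]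
  ring_nf

theorem thMat_mul_comm {n : ℕ} (a b : Fin n → ℝ) : thMat a * thMat b = thMat b * thMat a := by
  ext i l
  have : NeZero (2 * n) := ⟨by have := i.pos; omega⟩
  rw [thMat_mul_apply, thMat_mul_apply, sum_sub_mul_sub_comm,
    sum_sub_mul_sub_comm _ _ _ (-1 - (l.val : ZMod (2 * n)))]

theorem isUnit_det_gammaMat (n : ℕ) : IsUnit (gammaMat n).det := by
  have htri : (gammaMat n).BlockTriangular id := by
    intro i j hij
    have hij : j.val < i.val := hij
    simp only [gammaMat]
    rw [if_neg (by omega), if_neg (by omega)]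
  rw [Matrix.det_of_isUpperTriangular htri]
  simp [gammaMat]

theorem thMat_mulVec_single_zero {n : ℕ} (hn : 1 ≤ n) (a : Fin n → ℝ) :
    thMat a *ᵥ Pi.single ⟨0, hn⟩ 1 = gammaMat n *ᵥ a := by
  ext i
  have hi := i.isLt
  rw [Matrix.mulVec_single_one, Matrix.col_apply, Matrix.mulVec, dotProduct]
  have hsplit : ∀ j : Fin n, gammaMat n i j * a j =
      (if j = i then a j else 0) + (if j.val = i.val + 1 then a j else 0) := by
    intro j
    simp only [gammaMat, Fin.ext_iff]
    split_ifs <;> first | omega | simp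
  rw [Finset.sum_congr rfl fun j _ => hsplit j, Finset.sum_add_distrib,
    Finset.sum_ite_eq' Finset.univ i, if_pos (Finset.mem_univ i)]
  unfold thMat
  congr 1
  · simp
  · by_cases hd : i.val + 1 = n
    · rw [dif_pos (by simpa using hd), Finset.sum_eq_zero]
      intro j _
      exact if_neg (by omega)
    · rw [dif_neg (by simpa using hd), dif_pos (by simp; omega),
        Finset.sum_eq_single ⟨i.val + 1, by omega⟩]
      · simp
      · intro j _ hj
        exact if_neg fun h => hj (Fin.ext h)
      · simp

theorem starcVec_single_zero {n : ℕ} (hn : 1 ≤ n) (u : Fin n → ℝ) :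
    starcVec u (Pi.single ⟨0, hn⟩ 1) = u := by
  rw [starcVec, thMat_mulVec_single_zero, Matrix.mulVec_mulVec,
    Matrix.mul_nonsing_inv _ (isUnit_det_gammaMat n), Matrix.one_mulVec]

theorem starcVec_left_comm {n : ℕ} (u v w : Fin n → ℝ) :
    starcVec u (starcVec v w) = starcVec v (starcVec u w) := by
  simp only [starcVec, Matrix.mulVec_mulVec]
  rw [thMat_mul_comm]

theorem starcVec_comm {n : ℕ} (hn : 1 ≤ n) (u v : Fin n → ℝ) : starcVec u v = starcVec v u := by
  have h := starcVec_left_comm u v (Pi.single ⟨0, hn⟩ 1)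
  rwa [starcVec_single_zero, starcVec_single_zero] at h

/-- The vector `⋆_c` product is associative: for every `n ≥ 1` and all
`a, b, x ∈ ℝ^n`, `b ⋆_c (a ⋆_c x) = (b ⋆_c a) ⋆_c x`, i.e.
`Th(Γ⁻¹·b)·(Th(Γ⁻¹·a)·x) = Th(Γ⁻¹·(Th(Γ⁻¹·b)·a))·x`. -/
theorem starcVec_assoc (n : ℕ) (hn : 1 ≤ n) (a b x : Fin n → ℝ) :
    starcVec b (starcVec a x) = starcVec (starcVec b a) x := by
  rw [starcVec_comm hn a x, starcVec_left_comm, starcVec_comm hn x]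
end

section
/- Convolution with reflective boundary conditions is realized by the matrix Th(a): for every n ≥ 1, all a, x ∈ ℝ^n, and every i = 1,…,n, Σ_{j=i−n+1}^{i+n−1} h_{i−j}·x̃_j = (Th(a)·x)_i, where h_k = a_{|k|+1} for |k| ≤ n−1 and x̃ is the reflective extension of x. -/
open Matrix

/-- The reflective extension `x̃ : ℤ → ℝ` of `x ∈ ℝ^n` (indices are 1-based):
`x̃_j = x_j` for `1 ≤ j ≤ n`, `x̃_j = x_{1−j}` for `1−n ≤ j ≤ 0`,
`x̃_j = x_{2n+1−j}` for `n+1 ≤ j ≤ 2n`, and `0` outside this range. -/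
noncomputable def reflGet {n : ℕ} (x : Fin n → ℝ) (j : ℤ) : ℝ :=
  if h : 1 ≤ j ∧ j ≤ (n : ℤ) then x ⟨(j - 1).toNat, by omega⟩
  else if h : 1 - (n : ℤ) ≤ j ∧ j ≤ 0 then x ⟨(-j).toNat, by omega⟩
  else if h : (n : ℤ) + 1 ≤ j ∧ j ≤ 2 * n then x ⟨(2 * n - j).toNat, by omega⟩
  else 0

/-- The symmetric kernel `h : ℤ → ℝ` with `h_k = a_{|k|+1}` for `|k| ≤ n−1`
(and `0` outside this range, which is never used below). -/
noncomputable def kerH {n : ℕ} (a : Fin n → ℝ) (k : ℤ) : ℝ :=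
  if h : k.natAbs < n then a ⟨k.natAbs, h⟩ else 0

/-- A sum over the range `1 - n, …, 2n` of the reflective extension, folded onto the indices
`0, …, n - 1` of the original vector. -/
lemma sum_Ico_fold {M : Type*} [AddCommMonoid M] (n : ℕ) (f : ℤ → M) :
    ∑ j ∈ Finset.Ico (1 - (n : ℤ)) (2 * n + 1), f j =
      ∑ k : Fin n, (f (k + 1) + f (-k) + f (2 * n - k)) := by
  have hleft : ∑ j ∈ Finset.Ico (1 - (n : ℤ)) 1, f j = ∑ k ∈ Finset.range n, f (-k) := by
    refine Finset.sum_nbij' (fun j => (-j).toNat) (fun k => -(k : ℤ)) ?_ ?_ ?_ ?_ ?_ <;>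
      intro j hj <;> simp only [Finset.mem_Ico, Finset.mem_range] at hj ⊢
    · omega
    · omega
    · omega
    · omega
    · congr 1; omega
  have hmid : ∑ j ∈ Finset.Ico 1 ((n : ℤ) + 1), f j = ∑ k ∈ Finset.range n, f (k + 1) := by
    refine Finset.sum_nbij' (fun j => (j - 1).toNat) (fun k => (k : ℤ) + 1) ?_ ?_ ?_ ?_ ?_ <;>
      intro j hj <;> simp only [Finset.mem_Ico, Finset.mem_range] at hj ⊢
    · omega
    · omega
    · omega
    · omega
    · congr 1; omega
  have hright : ∑ j ∈ Finset.Ico ((n : ℤ) + 1) (2 * n + 1), f j =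
      ∑ k ∈ Finset.range n, f (2 * n - k) := by
    refine Finset.sum_nbij' (fun j => (2 * n - j).toNat) (fun k => 2 * n - (k : ℤ))
      ?_ ?_ ?_ ?_ ?_ <;>
      intro j hj <;> simp only [Finset.mem_Ico, Finset.mem_range] at hj ⊢
    · omega
    · omega
    · omega
    · omega
    · congr 1; omega
  rw [← Finset.Ico_union_Ico_eq_Ico (by omega : 1 - (n : ℤ) ≤ 1) (by omega),
    Finset.sum_union (Finset.Ico_disjoint_Ico_consecutive _ _ _),
    ← Finset.Ico_union_Ico_eq_Ico (by omega : (1 : ℤ) ≤ n + 1) (by omega),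
    Finset.sum_union (Finset.Ico_disjoint_Ico_consecutive _ _ _), hleft, hmid, hright,
    Finset.sum_add_distrib, Finset.sum_add_distrib, Finset.sum_range, Finset.sum_range,
    Finset.sum_range, add_left_comm, add_assoc]

lemma reflGet_add_one {n : ℕ} (x : Fin n → ℝ) (k : Fin n) : reflGet x (k + 1) = x k := by
  rw [reflGet, dif_pos (by omega)]
  congr 1
  ext
  simp

lemma reflGet_neg {n : ℕ} (x : Fin n → ℝ) (k : Fin n) : reflGet x (-k) = x k := by
  rw [reflGet, dif_neg (by omega), dif_pos (by omega)]
  congr 1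
  ext
  simp

lemma reflGet_two_mul_sub {n : ℕ} (x : Fin n → ℝ) (k : Fin n) :
    reflGet x (2 * n - k) = x k := by
  rw [reflGet, dif_neg (by omega), dif_neg (by omega), dif_pos (by omega)]
  congr 1
  ext
  simp

lemma kerH_of_natAbs_eq {n : ℕ} (a : Fin n → ℝ) {k : ℤ} {m : ℕ} (hm : m < n)
    (hk : k.natAbs = m) : kerH a k = a ⟨m, hm⟩ := by
  subst hk
  exact dif_pos hm

lemma kerH_of_le_natAbs {n : ℕ} (a : Fin n → ℝ) {k : ℤ} (hk : n ≤ k.natAbs) : kerH a k = 0 :=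
  dif_neg (not_lt.mpr hk)

/-- The entries of `thMat a` collect the kernel values at the index `j` and its two mirror
images. -/
lemma thMat_apply_eq_kerH {n : ℕ} (a : Fin n → ℝ) (i j : Fin n) :
    thMat a i j = kerH a ((i : ℤ) + 1 - (j + 1)) + kerH a ((i : ℤ) + 1 - -j) +
      kerH a ((i : ℤ) + 1 - (2 * n - j)) := by
  rw [thMat, add_assoc (kerH a _), kerH_of_natAbs_eq a (m := i - j + (j - i)) (by omega) (by omega)]
  congr 1
  split_ifs with hd hle
  · rw [kerH_of_le_natAbs a (by omega), kerH_of_le_natAbs a (by omega), add_zero]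
  · rw [kerH_of_natAbs_eq a (m := i + j + 1) (by omega) (by omega),
      kerH_of_le_natAbs a (by omega), add_zero]
  · rw [kerH_of_le_natAbs a (by omega),
      kerH_of_natAbs_eq a (m := 2 * n - 1 - (i + j)) (by omega) (by omega), zero_add]

/-- Convolution with reflective boundary conditions is realized by the matrix `Th(a)`:
for every `n ≥ 1`, all `a, x ∈ ℝ^n`, and every 1-based index `i = 1,…,n`,
`Σ_{j=i−n+1}^{i+n−1} h_{i−j}·x̃_j = (Th(a)·x)_i`. -/
theorem reflective_conv_eq_thMat (n : ℕ) (hn : 1 ≤ n) (a x : Fin n → ℝ) (i : Fin n) :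
    ∑ j ∈ Finset.Icc (((i.val : ℤ) + 1) - n + 1) (((i.val : ℤ) + 1) + n - 1),
        kerH a (((i.val : ℤ) + 1) - j) * reflGet x j
      = (thMat a *ᵥ x) i := by
  have hsub : Finset.Icc (((i.val : ℤ) + 1) - n + 1) (((i.val : ℤ) + 1) + n - 1) ⊆
      Finset.Ico (1 - (n : ℤ)) (2 * n + 1) := by
    intro j hj
    simp only [Finset.mem_Icc, Finset.mem_Ico] at hj ⊢
    omega
  rw [Finset.sum_subset hsub fun j _ hj => ?_, sum_Ico_fold]
  · simp only [mulVec, dotProduct, thMat_apply_eq_kerH, reflGet_add_one, reflGet_neg,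
      reflGet_two_mul_sub, add_mul]
  · rw [Finset.mem_Icc] at hj
    rw [kerH_of_le_natAbs a (by omega), zero_mul]
end

section
/- The three-order t-product is computed slice-wise in the Fourier domain: let A ∈ ℂ^{n1×n2×n3} and X ∈ ℂ^{n3×n2×n4} with mode-2 indices in ZMod n2, and let Y = A ⋆_t X. Then for every k ∈ ZMod n2, Σ_{i ∈ ZMod n2} W[k,i]·Y[:,i,:] = (Σ_{i ∈ ZMod n2} W[k,i]·A[:,i,:]) · (Σ_{j ∈ ZMod n2} W[k,j]·X[:,j,:]), where the right-hand side is a matrix product. -/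
open Matrix

/-- The DFT matrix `W ∈ ℂ^{n×n}` indexed by `ZMod n` with entries
`W[j,k] = exp(−2πi·jk/n)`. -/
noncomputable def dftW (n : ℕ) [NeZero n] : Matrix (ZMod n) (ZMod n) ℂ :=
  fun j k => Complex.exp (-2 * Real.pi * Complex.I * ((j.val : ℂ) * (k.val : ℂ)) / n)

/-- The entries of the DFT matrix are values of the standard additive character. -/
theorem dftW_eq_stdAddChar (n : ℕ) [NeZero n] (j k : ZMod n) :
    dftW n j k = ZMod.stdAddChar (-(j * k)) := by
  have h : -(j * k) = ((-((j.val : ℤ) * (k.val : ℤ)) : ℤ) : ZMod n) := by simp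
  rw [h, ZMod.stdAddChar_coe, dftW]
  congr 1
  push_cast
  ring

/-- Each row of the DFT matrix is an additive character. -/
theorem dftW_add (n : ℕ) [NeZero n] (k i j : ZMod n) :
    dftW n k (i + j) = dftW n k i * dftW n k j := by
  simp only [dftW_eq_stdAddChar, ← AddChar.map_add_eq_mul, mul_add, neg_add]

/-- The three-order t-product is computed slice-wise in the Fourier domain.
A 3-order tensor is represented by its family of mode-2 slices
`T : ZMod n2 → Matrix _ _ ℂ`, with `T i = T[:,i,:]`. If
`Y = A ⋆_t X`, i.e. `Y[:,i,:] = Σ_j A[:,i−j,:]·X[:,j,:]`, then for every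
`k`, `Σ_i W[k,i]·Y[:,i,:] = (Σ_i W[k,i]·A[:,i,:])·(Σ_j W[k,j]·X[:,j,:])`. -/
theorem tProduct_fourier_slicewise (n1 n2 n3 n4 : ℕ) [NeZero n2]
    (A : ZMod n2 → Matrix (Fin n1) (Fin n3) ℂ)
    (X : ZMod n2 → Matrix (Fin n3) (Fin n4) ℂ)
    (Y : ZMod n2 → Matrix (Fin n1) (Fin n4) ℂ)
    (hY : ∀ i : ZMod n2, Y i = ∑ j : ZMod n2, A (i - j) * X j)
    (k : ZMod n2) :
    ∑ i : ZMod n2, dftW n2 k i • Y i =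
      (∑ i : ZMod n2, dftW n2 k i • A i) * (∑ j : ZMod n2, dftW n2 k j • X j) := by
  simp only [hY, Finset.smul_sum, Matrix.mul_sum, Matrix.sum_mul]
  rw [Finset.sum_comm]
  refine Finset.sum_congr rfl fun j _ => ?_
  rw [← Equiv.sum_comp (Equiv.addRight j)]
  simp [dftW_add, mul_smul, smul_comm (dftW n2 k j)]
end

section
/- t-SVD for 3-order tensors: for every real tensor A ∈ ℝ^{n1×n2×n3} with mode-2 indices in ZMod n2, there exist real tensors U ∈ ℝ^{n1×n2×n1}, S ∈ ℝ^{n1×n2×n3}, V ∈ ℝ^{n3×n2×n3} such that A = U ⋆_t (S ⋆_t Vᵀ), S[i1,i2,i3] = 0 whenever i1 ≠ i3, and U, V are ⋆_t-orthogonal: Uᵀ ⋆_t U = E_{n1} and Vᵀ ⋆_t V = E_{n3}. -/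
open Matrix

/-- The t-product of 3-order real tensors (mode-2 circular block convolution):
`(A ⋆_t X)[i1,i,i3] = Σ_j Σ_l A[i1,i−j,l]·X[l,j,i3]`, i.e. slice-wise
`Y[:,i,:] = Σ_j A[:,i−j,:]·X[:,j,:]`. -/
noncomputable def tprod3 {p q r n2 : ℕ} [NeZero n2]
    (A : Fin p → ZMod n2 → Fin q → ℝ) (X : Fin q → ZMod n2 → Fin r → ℝ) :
    Fin p → ZMod n2 → Fin r → ℝ :=
  fun i1 i i3 => ∑ j : ZMod n2, ∑ l : Fin q, A i1 (i - j) l * X l j i3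

/-- The t-transpose: `Bᵀ[i1,i2,i3] = B[i3,−i2,i1]`. -/
def ttransp3 {p q n2 : ℕ} (B : Fin p → ZMod n2 → Fin q → ℝ) :
    Fin q → ZMod n2 → Fin p → ℝ :=
  fun i1 i2 i3 => B i3 (-i2) i1

/-- The identity tensor `E_m ∈ ℝ^{m×n2×m}`: `E_m[i1,0,i3] = δ_{i1,i3}` and the
other mode-2 slices vanish. -/
def tId3 (m n2 : ℕ) : Fin m → ZMod n2 → Fin m → ℝ :=
  fun i1 i2 i3 => if i2 = 0 ∧ i1 = i3 then 1 else 0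

open scoped ZMod

/-- Existence of a singular value decomposition of a linear map, in terms of orthonormal bases of
the domain and the codomain. -/
theorem LinearMap.exists_orthonormalBasis_inner_apply_eq_zero {𝕜 E F : Type*} [RCLike 𝕜]
    [NormedAddCommGroup E] [InnerProductSpace 𝕜 E] [FiniteDimensional 𝕜 E]
    [NormedAddCommGroup F] [InnerProductSpace 𝕜 F] [FiniteDimensional 𝕜 F]
    {m n : ℕ} (hn : Module.finrank 𝕜 E = n) (hm : Module.finrank 𝕜 F = m) (T : E →ₗ[𝕜] F) :
    ∃ (c : OrthonormalBasis (Fin m) 𝕜 F) (b : OrthonormalBasis (Fin n) 𝕜 E),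
      ∀ i j, i.val ≠ j.val → inner 𝕜 (c i) (T (b j)) = 0 := by
  set b := T.isSymmetric_adjoint_comp_self.eigenvectorBasis hn
  have inner_apply (i j : Fin n) : inner 𝕜 (T (b i)) (T (b j)) =
      if i = j then ((T.singularValues j : 𝕜)) ^ 2 else 0 := by
    have h : LinearMap.adjoint T (T (b j)) = ((T.singularValues j ^ 2 : ℝ) : 𝕜) • b j := by
      rw [T.sq_singularValues_fin hn]
      exact T.isSymmetric_adjoint_comp_self.apply_eigenvectorBasis hn j
    rw [← LinearMap.adjoint_inner_right, h, inner_smul_right,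
      orthonormal_iff_ite.mp b.orthonormal i j]
    split_ifs <;> simp
  have apply_eq_zero (j : Fin n) (h : T.singularValues j = 0) : T (b j) = 0 := by
    rw [← inner_self_eq_zero (𝕜 := 𝕜), inner_apply, h]
    simp
  have lt_of_ne_zero (j : ℕ) (h : T.singularValues j ≠ 0) : j < m := by
    rw [← T.singularValues_pos_iff_ne_zero, T.singularValues_pos_iff_lt_finrank_range] at h
    exact hm ▸ h.trans_le (Submodule.finrank_le _)
  have lt_of_ne_zero' (j : ℕ) (h : T.singularValues j ≠ 0) : j < n := by
    by_contra! hj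
    exact h (T.singularValues_of_finrank_le (hn ▸ hj))
  let v : Fin m → F := fun i =>
    if h : i.val < n then ((T.singularValues i : 𝕜))⁻¹ • T (b ⟨i, h⟩) else 0
  have hv : Orthonormal 𝕜 (({i | T.singularValues i ≠ 0} : Set (Fin m)).domRestrict v) := by
    rw [orthonormal_iff_ite]
    rintro ⟨i, hi⟩ ⟨j, hj⟩
    have hi' : (T.singularValues i : 𝕜) ≠ 0 := by exact_mod_cast hi
    simp only [Set.domRestrict_apply, v, dif_pos (lt_of_ne_zero' _ hi),
      dif_pos (lt_of_ne_zero' _ hj), inner_smul_left, inner_smul_right, inner_apply,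
      Subtype.mk.injEq, Fin.ext_iff]
    split_ifs with hij
    · rw [← hij]
      simp only [map_inv₀, RCLike.conj_ofReal]
      field_simp
    · simp
  obtain ⟨c, hc⟩ := hv.exists_orthonormalBasis_extension_of_card_eq (by simpa using hm)
  refine ⟨c, b, fun i j hij => ?_⟩
  by_cases h : T.singularValues j = 0
  · simp [apply_eq_zero j h]
  have h' : (T.singularValues j : 𝕜) ≠ 0 := by exact_mod_cast h
  have hcj : T (b j) = (T.singularValues j : 𝕜) • c ⟨j, lt_of_ne_zero j h⟩ := by
    rw [hc ⟨j, lt_of_ne_zero j h⟩ h]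
    simp [v, h']
  rw [hcj, inner_smul_right, orthonormal_iff_ite.mp c.orthonormal,
    if_neg (by simpa [Fin.ext_iff] using hij), mul_zero]

namespace Matrix

/-- The unitary matrices `U` and `V` diagonalize the rectangular matrix `M`, that is, they are
the outer factors of a singular value decomposition of `M` (up to the phases of the diagonal). -/
structure IsSVDPair {𝕜 : Type*} [RCLike 𝕜] {m n : ℕ} (M : Matrix (Fin m) (Fin n) 𝕜)
    (U : Matrix (Fin m) (Fin m) 𝕜) (V : Matrix (Fin n) (Fin n) 𝕜) : Prop where
  left_unitary : Uᴴ * U = 1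
  right_unitary : Vᴴ * V = 1
  diagonal : ∀ i j, i.val ≠ j.val → (Uᴴ * M * V) i j = 0

theorem exists_isSVDPair {𝕜 : Type*} [RCLike 𝕜] {m n : ℕ} (M : Matrix (Fin m) (Fin n) 𝕜) :
    ∃ U V, M.IsSVDPair U V := by
  obtain ⟨c, b, h⟩ := LinearMap.exists_orthonormalBasis_inner_apply_eq_zero
    (E := EuclideanSpace 𝕜 (Fin n)) (F := EuclideanSpace 𝕜 (Fin m))
    finrank_euclideanSpace_fin finrank_euclideanSpace_fin (toEuclideanLin M)
  refine ⟨of fun i j => c j i, of fun i j => b j i, ?_, ?_, fun i j hij => ?_⟩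
  · ext i j
    simpa [mul_apply, one_apply, PiLp.inner_apply, mul_comm] using
      orthonormal_iff_ite.mp c.orthonormal i j
  · ext i j
    simpa [mul_apply, one_apply, PiLp.inner_apply, mul_comm] using
      orthonormal_iff_ite.mp b.orthonormal i j
  · rw [← h i j hij, Matrix.mul_assoc]
    simp [mul_apply, PiLp.inner_apply, toLpLin_apply, mulVec, dotProduct, mul_comm]

/-- Transport along a star-preserving ring homomorphism. -/
theorem IsSVDPair.map {𝕜 𝕜' : Type*} [RCLike 𝕜] [RCLike 𝕜'] {m n : ℕ}
    {M : Matrix (Fin m) (Fin n) 𝕜} {U : Matrix (Fin m) (Fin m) 𝕜} {V : Matrix (Fin n) (Fin n) 𝕜}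
    (h : M.IsSVDPair U V) (f : 𝕜 →+* 𝕜') (hf : Function.Semiconj f star star) :
    (M.map f).IsSVDPair (U.map f) (V.map f) where
  left_unitary := by
    rw [← conjTranspose_map _ hf, ← Matrix.map_mul, h.left_unitary,
      Matrix.map_one _ (map_zero f) (map_one f)]
  right_unitary := by
    rw [← conjTranspose_map _ hf, ← Matrix.map_mul, h.right_unitary,
      Matrix.map_one _ (map_zero f) (map_one f)]
  diagonal i j hij := by
    rw [← conjTranspose_map _ hf, ← Matrix.map_mul, ← Matrix.map_mul, map_apply,
      h.diagonal i j hij, map_zero]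

theorem IsSVDPair.map_star {m n : ℕ} {M : Matrix (Fin m) (Fin n) ℂ}
    {U : Matrix (Fin m) (Fin m) ℂ} {V : Matrix (Fin n) (Fin n) ℂ} (h : M.IsSVDPair U V) :
    (M.map star).IsSVDPair (U.map star) (V.map star) :=
  h.map (starRingEnd ℂ) fun _ => rfl

/-- A complex matrix with real entries is diagonalized by a pair of real orthogonal matrices. -/
theorem exists_isSVDPair_of_map_star_eq {m n : ℕ} {M : Matrix (Fin m) (Fin n) ℂ}
    (hM : M.map star = M) :
    ∃ U V, M.IsSVDPair U V ∧ U.map star = U ∧ V.map star = V := by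
  obtain ⟨U, V, h⟩ := exists_isSVDPair (M.map Complex.re)
  have key := h.map Complex.ofRealHom fun x => (Complex.conj_ofReal x).symm
  have hM' : (M.map Complex.re).map Complex.ofRealHom = M := by
    ext i j
    exact Complex.conj_eq_iff_re.mp (congrFun₂ hM i j)
  rw [hM'] at key
  refine ⟨_, _, key, ?_, ?_⟩ <;>
  · ext i j
    exact Complex.conj_ofReal _

/-- A conjugation-symmetric family of matrices is diagonalized by conjugation-symmetric families. -/
theorem exists_isSVDPair_of_neg_eq_map_star {N m n : ℕ} [NeZero N]
    {M : ZMod N → Matrix (Fin m) (Fin n) ℂ} (hM : ∀ k, M (-k) = (M k).map star) :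
    ∃ (U : ZMod N → Matrix (Fin m) (Fin m) ℂ) (V : ZMod N → Matrix (Fin n) (Fin n) ℂ),
      (∀ k, (M k).IsSVDPair (U k) (V k)) ∧ (∀ k, U (-k) = (U k).map star) ∧
        ∀ k, V (-k) = (V k).map star := by
  have key (k : ZMod N) : ∃ U V, (M k).IsSVDPair U V ∧
      (-k = k → U.map star = U ∧ V.map star = V) := by
    by_cases hk : -k = k
    · obtain ⟨U, V, h, hU, hV⟩ := exists_isSVDPair_of_map_star_eq (M := M k) (by rw [← hM, hk])
      exact ⟨U, V, h, fun _ => ⟨hU, hV⟩⟩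
    · obtain ⟨U, V, h⟩ := exists_isSVDPair (M k)
      exact ⟨U, V, h, fun h => absurd h hk⟩
  choose U V h hreal using key
  have symm {p : ℕ} (W : ZMod N → Matrix (Fin p) (Fin p) ℂ)
      (hW : ∀ k, -k = k → (W k).map star = W k) (k : ZMod N) :
      (if (-k).val ≤ (- -k).val then W (-k) else (W (- -k)).map star) =
        (if k.val ≤ (-k).val then W k else (W (-k)).map star).map star := by
    rw [neg_neg]
    rcases lt_trichotomy k.val (-k).val with hk | hk | hk
    · rw [if_neg hk.not_ge, if_pos hk.le]
    · have hk' : -k = k := (ZMod.val_injective N hk).symm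
      simp only [hk', le_refl, if_true, hW k hk']
    · rw [if_pos hk.le, if_neg hk.not_ge]
      ext
      simp
  refine ⟨fun k => if k.val ≤ (-k).val then U k else (U (-k)).map star,
    fun k => if k.val ≤ (-k).val then V k else (V (-k)).map star, fun k => ?_,
    symm U fun k hk => (hreal k hk).1, symm V fun k hk => (hreal k hk).2⟩
  dsimp only
  split_ifs with hk
  · exact h k
  · have := (h (-k)).map_star
    rwa [← hM, neg_neg] at this

end Matrix

/-- The discrete Fourier transform of a real tensor along its second mode. -/
noncomputable def tdft3 {p q n2 : ℕ} [NeZero n2] (A : Fin p → ZMod n2 → Fin q → ℝ) :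
    ZMod n2 → Matrix (Fin p) (Fin q) ℂ :=
  fun k => of fun a b => 𝓕 (fun j => (A a j b : ℂ)) k

theorem tdft3_apply {p q n2 : ℕ} [NeZero n2] (A : Fin p → ZMod n2 → Fin q → ℝ) (k : ZMod n2)
    (a : Fin p) (b : Fin q) :
    tdft3 A k a b = ∑ j, ZMod.stdAddChar (-(j * k)) * (A a j b : ℂ) :=
  rfl

theorem tdft3_injective {p q n2 : ℕ} [NeZero n2] :
    Function.Injective (tdft3 : (Fin p → ZMod n2 → Fin q → ℝ) → _) := by
  intro A B h
  ext a j b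
  have : 𝓕 (fun j => (A a j b : ℂ)) = 𝓕 (fun j => (B a j b : ℂ)) :=
    funext fun k => congrFun₂ (congrFun h k) a b
  exact_mod_cast congrFun (ZMod.dft.injective this) j

theorem apply_eq_zero_of_tdft3_apply_eq_zero {p q n2 : ℕ} [NeZero n2]
    {A : Fin p → ZMod n2 → Fin q → ℝ} {a : Fin p} {b : Fin q} (h : ∀ k, tdft3 A k a b = 0)
    (j : ZMod n2) : A a j b = 0 := by
  have : 𝓕 (fun j => (A a j b : ℂ)) = 0 := funext h
  exact Complex.ofReal_eq_zero.mp (congrFun ((LinearEquiv.map_eq_zero_iff _).mp this) j)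

theorem ZMod.conj_stdAddChar {N : ℕ} [NeZero N] (j : ZMod N) :
    (starRingEnd ℂ) (stdAddChar j) = stdAddChar (-j) :=
  (AddChar.map_neg_eq_conj _ _).symm

theorem tdft3_neg {p q n2 : ℕ} [NeZero n2] (A : Fin p → ZMod n2 → Fin q → ℝ) (k : ZMod n2) :
    tdft3 A (-k) = (tdft3 A k).map star := by
  ext a b
  simp [tdft3_apply, ZMod.conj_stdAddChar]

theorem tdft3_tprod3 {p q r n2 : ℕ} [NeZero n2] (A : Fin p → ZMod n2 → Fin q → ℝ)
    (X : Fin q → ZMod n2 → Fin r → ℝ) (k : ZMod n2) :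
    tdft3 (tprod3 A X) k = tdft3 A k * tdft3 X k := by
  ext a b
  simp only [tdft3_apply, tprod3, mul_apply, Complex.ofReal_sum, Complex.ofReal_mul,
    Finset.mul_sum, Finset.sum_mul]
  rw [Finset.sum_comm, Finset.sum_comm (s := Finset.univ (α := Fin q))]
  refine Finset.sum_congr rfl fun j _ => ?_
  rw [Finset.sum_comm]
  refine Finset.sum_congr rfl fun l _ => ?_
  refine Fintype.sum_equiv (Equiv.subRight j) _ _ fun i => ?_
  have : -(i * k) = -((i - j) * k) + -(j * k) := by ring
  rw [Equiv.subRight_apply, this, AddChar.map_add_eq_mul]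
  ring

theorem tdft3_ttransp3 {p q n2 : ℕ} [NeZero n2] (B : Fin p → ZMod n2 → Fin q → ℝ)
    (k : ZMod n2) : tdft3 (ttransp3 B) k = (tdft3 B k)ᴴ := by
  ext a b
  simp only [tdft3_apply, ttransp3, conjTranspose_apply, ← starRingEnd_apply, map_sum, map_mul,
    ZMod.conj_stdAddChar, Complex.conj_ofReal]
  exact Fintype.sum_equiv (Equiv.neg _) _ _ fun j => by simp

theorem tdft3_tId3 (m n2 : ℕ) [NeZero n2] (k : ZMod n2) : tdft3 (tId3 m n2) k = 1 := by
  ext a b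
  rw [tdft3_apply, Finset.sum_eq_single 0 (fun j _ hj => by simp [tId3, hj]) (by simp)]
  by_cases hab : a = b <;> simp [tId3, one_apply, hab]

theorem exists_tdft3_eq {p q n2 : ℕ} [NeZero n2] {F : ZMod n2 → Matrix (Fin p) (Fin q) ℂ}
    (hF : ∀ k, F (-k) = (F k).map star) : ∃ B, tdft3 B = F := by
  let G : Fin p → ZMod n2 → Fin q → ℂ := fun a j b => 𝓕⁻ (fun k => F k a b) j
  have hG (a j b) : ((G a j b).re : ℂ) = G a j b := by
    refine Complex.conj_eq_iff_re.mp ?_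
    simp only [G, ZMod.invDFT_apply, smul_eq_mul, map_mul, map_inv₀, map_natCast, map_sum,
      ZMod.conj_stdAddChar]
    congr 1
    refine Fintype.sum_equiv (Equiv.neg _) _ _ fun k => ?_
    simp [hF]
  refine ⟨fun a j b => (G a j b).re, ?_⟩
  ext k a b
  simp only [tdft3, of_apply, hG]
  exact congrFun (LinearEquiv.apply_symm_apply _ _) k

/-- t-SVD for 3-order tensors: every real `A ∈ ℝ^{n1×n2×n3}` factors as
`A = U ⋆_t (S ⋆_t Vᵀ)` with `S` f-diagonal and `U, V` ⋆_t-orthogonal. -/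
theorem tSVD3 (n1 n2 n3 : ℕ) [NeZero n2] (A : Fin n1 → ZMod n2 → Fin n3 → ℝ) :
    ∃ (U : Fin n1 → ZMod n2 → Fin n1 → ℝ)
      (S : Fin n1 → ZMod n2 → Fin n3 → ℝ)
      (V : Fin n3 → ZMod n2 → Fin n3 → ℝ),
      A = tprod3 U (tprod3 S (ttransp3 V)) ∧
      (∀ (i1 : Fin n1) (i2 : ZMod n2) (i3 : Fin n3), i1.val ≠ i3.val → S i1 i2 i3 = 0) ∧
      tprod3 (ttransp3 U) U = tId3 n1 n2 ∧
      tprod3 (ttransp3 V) V = tId3 n3 n2 := by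
  obtain ⟨P, Q, h, hP, hQ⟩ := exists_isSVDPair_of_neg_eq_map_star (tdft3_neg A)
  obtain ⟨U, rfl⟩ := exists_tdft3_eq hP
  obtain ⟨V, rfl⟩ := exists_tdft3_eq hQ
  refine ⟨U, tprod3 (tprod3 (ttransp3 U) A) V, V, tdft3_injective (funext fun k => ?_),
    fun i1 i2 i3 hi => apply_eq_zero_of_tdft3_apply_eq_zero (fun k => ?_) i2,
    tdft3_injective (funext fun k => ?_), tdft3_injective (funext fun k => ?_)⟩
  · simp only [tdft3_tprod3, tdft3_ttransp3, Matrix.mul_assoc]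
    rw [mul_eq_one_comm.mp (h k).right_unitary, ← Matrix.mul_assoc,
      mul_eq_one_comm.mp (h k).left_unitary, Matrix.one_mul, Matrix.mul_one]
  · simpa only [tdft3_tprod3, tdft3_ttransp3] using (h k).diagonal i1 i3 hi
  · rw [tdft3_tprod3, tdft3_ttransp3, tdft3_tId3, (h k).left_unitary]
  · rw [tdft3_tprod3, tdft3_ttransp3, tdft3_tId3, (h k).right_unitary]
end
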